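/- arXiv:1411.6550 — 5 statements merged into one kernel-verified Lean document; each statement's English description precedes it below -/
import Mathlib

section
/- Let q₀ : ℝ → ℂ be measurable, integrable, and bounded. For ω, z' ∈ ℝ set q(ω, z') := exp(i z' ω²) · q₀(ω), and define the trilinear integral N_ω(z') := ∫_{ℝ²} q(ω₁, z') q(ω₂, z') conj(q(ω₁ + ω₂ − ω, z')) dω₁ dω₂. Then for every ω ∈ ℝ and every z ≥ 0, ∫₀^z exp(−i z' ω²) N_ω(z') dz' = i ∫_{ℝ²} H(Ω(ω₁, ω₂, ω))(z) · q₀(ω₁) q₀(ω₂) conj(q₀(ω₁ + ω₂ − ω)) dω₁ dω₂, where Ω(ω₁, ω₂, ω) := ω₁² + ω₂² − (ω₁ + ω₂ − ω)² − ω². (Paper's Lemma 1, with the frequency-matching Dirac delta integrated out.) -/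
open MeasureTheory intervalIntegral
open scoped ComplexConjugate

/-- The `H`-function: `H(Ω)(z) = (1 - exp(iΩz))/Ω` for `Ω ≠ 0`, and
`H(0)(z) = -iz`. -/
noncomputable def Hfun (Ω z : ℝ) : ℂ :=
  if Ω = 0 then -Complex.I * z
  else (1 - Complex.exp (Complex.I * Ω * z)) / Ω

/-- The free evolution `q(ω, z') = exp(iz'ω²) q₀(ω)` of the initial data. -/
noncomputable def freeEvol (q₀ : ℝ → ℂ) (ω z' : ℝ) : ℂ :=
  Complex.exp (Complex.I * z' * ω ^ 2) * q₀ ω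

/-- The trilinear integral `N_ω(z')` with the frequency-matching delta
integrated out: `∫_{ℝ²} q(ω₁,z') q(ω₂,z') conj(q(ω₁+ω₂-ω,z')) dω₁dω₂`. -/
noncomputable def Ntri (q₀ : ℝ → ℂ) (ω z' : ℝ) : ℂ :=
  ∫ p : ℝ × ℝ,
    freeEvol q₀ p.1 z' * freeEvol q₀ p.2 z' *
      conj (freeEvol q₀ (p.1 + p.2 - ω) z')

theorem integral_exp_I_mul_eq_Hfun (Ω z : ℝ) :
    ∫ t in (0 : ℝ)..z, Complex.exp (Complex.I * Ω * t) = Complex.I * Hfun Ω z := by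
  unfold Hfun
  split_ifs with h
  · subst h
    simp [← mul_assoc]
  · have hΩ : (Ω : ℂ) ≠ 0 := by exact_mod_cast h
    rw [integral_exp_mul_complex (mul_ne_zero Complex.I_ne_zero hΩ)]
    field_simp
    simp only [Complex.ofReal_zero, mul_zero, Complex.exp_zero, Complex.I_sq]
    ring

theorem integrable_trilinear {q₀ : ℝ → ℂ} (hmeas : Measurable q₀) (hint : Integrable q₀) {C : ℝ}
    (hbd : ∀ x : ℝ, ‖q₀ x‖ ≤ C) (ω : ℝ) :
    Integrable fun p : ℝ × ℝ => q₀ p.1 * q₀ p.2 * conj (q₀ (p.1 + p.2 - ω)) := by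
  refine (hint.mul_prod hint).mul_bdd (c := C) ?_ ?_
  · exact (Complex.continuous_conj.measurable.comp
      (hmeas.comp (by fun_prop))).aestronglyMeasurable
  · exact .of_forall fun p => by simpa using hbd _

theorem exp_mul_freeEvol_mul_freeEvol_mul_conj_freeEvol (q₀ : ℝ → ℂ) (ω t x y : ℝ) :
    Complex.exp (-(Complex.I * t * ω ^ 2)) *
        (freeEvol q₀ x t * freeEvol q₀ y t * conj (freeEvol q₀ (x + y - ω) t)) =
      Complex.exp (Complex.I * ((x ^ 2 + y ^ 2 - (x + y - ω) ^ 2 - ω ^ 2 : ℝ) : ℂ) * t) *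
        (q₀ x * q₀ y * conj (q₀ (x + y - ω))) := by
  have h : Complex.exp (Complex.I * ((x ^ 2 + y ^ 2 - (x + y - ω) ^ 2 - ω ^ 2 : ℝ) : ℂ) * t) =
      Complex.exp (-(Complex.I * t * ω ^ 2)) * Complex.exp (Complex.I * t * x ^ 2) *
        Complex.exp (Complex.I * t * y ^ 2) *
        Complex.exp (-(Complex.I * t * ((x + y - ω : ℝ) : ℂ) ^ 2)) := by
    rw [← Complex.exp_add, ← Complex.exp_add, ← Complex.exp_add]
    push_cast
    ring_nf
  simp only [freeEvol, h, map_mul, ← Complex.exp_conj, map_pow, Complex.conj_I,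
    Complex.conj_ofReal, neg_mul]
  ring

/-- Lemma 1 of the paper (with the frequency-matching Dirac delta integrated
out): for measurable, integrable, bounded initial data `q₀`, every `ω` and
every `z ≥ 0`,
`∫₀^z exp(-iz'ω²) N_ω(z') dz'
  = i ∫_{ℝ²} H(Ω(ω₁,ω₂,ω))(z) q₀(ω₁)q₀(ω₂) conj(q₀(ω₁+ω₂-ω)) dω₁dω₂`,
where `Ω(ω₁,ω₂,ω) = ω₁² + ω₂² - (ω₁+ω₂-ω)² - ω²`. -/
theorem zero_to_first_order (q₀ : ℝ → ℂ) (hmeas : Measurable q₀)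
    (hint : Integrable q₀) (C : ℝ) (hbd : ∀ x : ℝ, ‖q₀ x‖ ≤ C)
    (ω z : ℝ) (hz : 0 ≤ z) :
    (∫ z' in (0 : ℝ)..z,
        Complex.exp (-(Complex.I * z' * ω ^ 2)) * Ntri q₀ ω z')
      = Complex.I * ∫ p : ℝ × ℝ,
          Hfun (p.1 ^ 2 + p.2 ^ 2 - (p.1 + p.2 - ω) ^ 2 - ω ^ 2) z *
            (q₀ p.1 * q₀ p.2 * conj (q₀ (p.1 + p.2 - ω))) := by
  set Ω : ℝ × ℝ → ℝ := fun p => p.1 ^ 2 + p.2 ^ 2 - (p.1 + p.2 - ω) ^ 2 - ω ^ 2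
  set g : ℝ × ℝ → ℂ := fun p => q₀ p.1 * q₀ p.2 * conj (q₀ (p.1 + p.2 - ω))
  have hg : Integrable g := integrable_trilinear hmeas hint hbd ω
  have : IsFiniteMeasure (volume.restrict (Set.uIoc 0 z)) := by
    rw [Set.uIoc_of_le hz]
    infer_instance
  have hF : Integrable (Function.uncurry fun (t : ℝ) (p : ℝ × ℝ) =>
      Complex.exp (Complex.I * Ω p * t) * g p)
      ((volume.restrict (Set.uIoc 0 z)).prod volume) := by
    refine (hg.comp_snd (volume.restrict (Set.uIoc 0 z))).bdd_mul (c := 1) ?_ ?_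
    · refine Continuous.aestronglyMeasurable ?_
      fun_prop
    · refine .of_forall fun p => le_of_eq ?_
      rw [mul_assoc, mul_comm, ← Complex.ofReal_mul, Complex.norm_exp_ofReal_mul_I]
  calc _ = ∫ t in (0 : ℝ)..z, ∫ p : ℝ × ℝ, Complex.exp (Complex.I * Ω p * t) * g p := by
        refine integral_congr fun t _ => ?_
        simp only [Ntri]
        rw [← MeasureTheory.integral_const_mul]
        exact MeasureTheory.integral_congr_ae (.of_forall fun p =>
          exp_mul_freeEvol_mul_freeEvol_mul_conj_freeEvol q₀ ω t p.1 p.2)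
    _ = ∫ p : ℝ × ℝ, ∫ t in (0 : ℝ)..z, Complex.exp (Complex.I * Ω p * t) * g p :=
        intervalIntegral_integral_swap hF
    _ = _ := by
        rw [← MeasureTheory.integral_const_mul]
        refine MeasureTheory.integral_congr_ae (.of_forall fun p => ?_)
        simp only [intervalIntegral.integral_mul_const, integral_exp_I_mul_eq_Hfun]
        exact mul_assoc _ _ _
end

section
/- Let S⁰ : ℤ → ℝ be finitely supported and fix real numbers ω₀ and z. Then Σ_{k ∈ ℤ} Σ_{(l,m,n) ∈ nr_k} |H(Ω_{lmnk})(z)|² T_{lmnk}(S⁰) = 0 (all sums having finitely many nonzero terms). Equivalently, the KZ power spectral density is energy preserving: Σ_{k ∈ ℤ} S_k^{KZ}(z) = Σ_{k ∈ ℤ} S⁰(k). -/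
/-- The phase mismatch `Ω_{lmnk} = ω₀²(l² + m² - n² - k²)`. -/
def Om (ω₀ : ℝ) (l m n k : ℤ) : ℝ :=
  ω₀ ^ 2 * ((l : ℝ) ^ 2 + (m : ℝ) ^ 2 - (n : ℝ) ^ 2 - (k : ℝ) ^ 2)

/-- The collision term `T_{lmnk}(S)`. -/
def collisionTerm (S : ℤ → ℝ) (l m n k : ℤ) : ℝ :=
  S l * S m * S n + S l * S m * S k - S l * S n * S k - S m * S n * S k

/-- The summand of the KZ interference sum at frequency `k`: the value
`|H(Ω_{lmnk})(z)|² T_{lmnk}(S⁰)` on the non-resonant set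
`nr_k = {(l,m,n) : l + m = n + k, l ≠ k, m ≠ k}`, and `0` off it. -/
noncomputable def kzSummand (S0 : ℤ → ℝ) (ω₀ z : ℝ) (k : ℤ)
    (t : ℤ × ℤ × ℤ) : ℝ :=
  if t.1 + t.2.1 = t.2.2 + k ∧ t.1 ≠ k ∧ t.2.1 ≠ k then
    ‖Hfun (Om ω₀ t.1 t.2.1 t.2.2 k) z‖ ^ 2 * collisionTerm S0 t.1 t.2.1 t.2.2 k
  else 0

/-- The KZ power spectral density at distance `z`. -/
noncomputable def SKZ (S0 : ℤ → ℝ) (ω₀ z : ℝ) (k : ℤ) : ℝ :=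
  S0 k + 8 * ∑ᶠ t : ℤ × ℤ × ℤ, kzSummand S0 ω₀ z k t

/-- The modulus of `H` does not see the sign of the phase mismatch. -/
lemma norm_Hfun_neg (Ω z : ℝ) : ‖Hfun (-Ω) z‖ = ‖Hfun Ω z‖ := by
  unfold Hfun
  by_cases h : Ω = 0
  · simp [h]
  · have hconj : (1 - Complex.exp (Complex.I * ((-Ω : ℝ) : ℂ) * z))
        = (starRingEnd ℂ) (1 - Complex.exp (Complex.I * Ω * z)) := by
      rw [map_sub, map_one, ← Complex.exp_conj]
      simp
    rw [if_neg h, if_neg (neg_ne_zero.mpr h), hconj, norm_div, norm_div, Complex.norm_conj]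
    simp

lemma Om_swap (ω₀ : ℝ) (l m n k : ℤ) : Om ω₀ n k l m = -Om ω₀ l m n k := by
  unfold Om; ring

lemma collisionTerm_swap (S : ℤ → ℝ) (l m n k : ℤ) :
    collisionTerm S n k l m = -collisionTerm S l m n k := by
  unfold collisionTerm; ring

/-- Exchanging the incoming pair `(l, m)` and the outgoing pair `(n, k)` flips the sign of the
summand. -/
lemma kzSummand_swap (S0 : ℤ → ℝ) (ω₀ z : ℝ) (l m n k : ℤ) :
    kzSummand S0 ω₀ z m (n, k, l) = -kzSummand S0 ω₀ z k (l, m, n) := by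
  have hiff : (n + k = l + m ∧ n ≠ m ∧ k ≠ m) ↔ (l + m = n + k ∧ l ≠ k ∧ m ≠ k) := by
    omega
  simp only [kzSummand, hiff, Om_swap ω₀ l m n k, norm_Hfun_neg, collisionTerm_swap S0 l m n k]
  split_ifs <;> simp

/-- A nonvanishing collision term involves at least three frequencies in the support of `S`. -/
lemma support_of_collisionTerm_ne_zero {S : ℤ → ℝ} {l m n k : ℤ}
    (h : collisionTerm S l m n k ≠ 0) :
    (S l ≠ 0 ∧ S m ≠ 0 ∧ S n ≠ 0) ∨ (S l ≠ 0 ∧ S m ≠ 0 ∧ S k ≠ 0) ∨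
      (S l ≠ 0 ∧ S n ≠ 0 ∧ S k ≠ 0) ∨ (S m ≠ 0 ∧ S n ≠ 0 ∧ S k ≠ 0) := by
  by_cases hl : S l = 0 <;> by_cases hm : S m = 0 <;> by_cases hn : S n = 0 <;>
    by_cases hk : S k = 0 <;> simp_all [collisionTerm]

lemma finite_support_kzSummand_uncurry {S0 : ℤ → ℝ} (hS : (Function.support S0).Finite)
    (ω₀ z : ℝ) :
    (Function.support fun p : ℤ × ℤ × ℤ × ℤ => kzSummand S0 ω₀ z p.1 p.2).Finite := by
  obtain ⟨a, ha⟩ := hS.bddBelow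
  obtain ⟨b, hb⟩ := hS.bddAbove
  have hbd : ∀ x, S0 x ≠ 0 → a ≤ x ∧ x ≤ b := fun x hx => ⟨ha hx, hb hx⟩
  let c := min a (2 * a - b)
  let d := max b (2 * b - a)
  refine (Set.finite_Icc ((c, c, c, c) : ℤ × ℤ × ℤ × ℤ) (d, d, d, d)).subset ?_
  rintro ⟨k, l, m, n⟩ h
  simp only [Function.mem_support, kzSummand, ne_eq, ite_eq_right_iff, Classical.not_imp,
    mul_eq_zero, not_or] at h
  obtain ⟨⟨hsum, -, -⟩, -, hT⟩ := h
  simp only [Set.mem_Icc, Prod.mk_le_mk]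
  have hl := hbd l
  have hm := hbd m
  have hn := hbd n
  have hk := hbd k
  rcases support_of_collisionTerm_ne_zero hT with
    ⟨h₁, h₂, h₃⟩ | ⟨h₁, h₂, h₃⟩ | ⟨h₁, h₂, h₃⟩ | ⟨h₁, h₂, h₃⟩ <;>
  · simp only [h₁, h₂, h₃, ne_eq, not_false_eq_true, forall_const] at hl hm hn hk
    omega

/-- The involution exchanging `(l, m)` with `(n, k)`, on tuples ordered as `(k, l, m, n)`. -/
def swapPairs : (ℤ × ℤ × ℤ × ℤ) ≃ (ℤ × ℤ × ℤ × ℤ) where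
  toFun p := (p.2.2.1, p.2.2.2, p.1, p.2.1)
  invFun p := (p.2.2.1, p.2.2.2, p.1, p.2.1)
  left_inv _ := rfl
  right_inv _ := rfl

lemma finsum_kzSummand_uncurry (S0 : ℤ → ℝ) (ω₀ z : ℝ) :
    ∑ᶠ p : ℤ × ℤ × ℤ × ℤ, kzSummand S0 ω₀ z p.1 p.2 = 0 := by
  refine self_eq_neg.mp ?_
  rw [← finsum_neg_distrib]
  refine (finsum_comp_equiv swapPairs).symm.trans (finsum_congr ?_)
  rintro ⟨k, l, m, n⟩
  exact kzSummand_swap S0 ω₀ z l m n k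

/-- The KZ power spectral density is energy preserving: for a finitely
supported input spectrum `S⁰`, all sums below have finitely many nonzero
terms, the total KZ interference `Σ_k Σ_{nr_k} |H(Ω_{lmnk})(z)|² T_{lmnk}(S⁰)`
vanishes, and `Σ_k S_k^{KZ}(z) = Σ_k S⁰(k)`. -/
theorem kz_energy_preserving (S0 : ℤ → ℝ)
    (hS : (Function.support S0).Finite) (ω₀ z : ℝ) :
    (∀ k : ℤ, (Function.support (kzSummand S0 ω₀ z k)).Finite) ∧
    (Function.support (fun k : ℤ =>
        ∑ᶠ t : ℤ × ℤ × ℤ, kzSummand S0 ω₀ z k t)).Finite ∧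
    (Function.support (fun k : ℤ => SKZ S0 ω₀ z k)).Finite ∧
    (∑ᶠ k : ℤ, ∑ᶠ t : ℤ × ℤ × ℤ, kzSummand S0 ω₀ z k t = 0) ∧
    (∑ᶠ k : ℤ, SKZ S0 ω₀ z k = ∑ᶠ k : ℤ, S0 k) := by
  have hfin := finite_support_kzSummand_uncurry hS ω₀ z
  have hinner : ∀ k : ℤ, (Function.support (kzSummand S0 ω₀ z k)).Finite := fun k =>
    hfin.preimage (f := fun t => (k, t)) (Prod.mk_right_injective k).injOn
  have houter : (Function.support (fun k : ℤ =>
      ∑ᶠ t : ℤ × ℤ × ℤ, kzSummand S0 ω₀ z k t)).Finite := by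
    refine (hfin.image Prod.fst).subset fun k hk => ?_
    by_contra hnot
    exact hk (finsum_eq_zero_of_forall_eq_zero fun t => by_contra fun ht => hnot ⟨(k, t), ht, rfl⟩)
  have houter8 : (Function.support (fun k : ℤ =>
      8 * ∑ᶠ t : ℤ × ℤ × ℤ, kzSummand S0 ω₀ z k t)).Finite :=
    houter.subset (Function.support_mul_subset_right _ _)
  have hzero : ∑ᶠ k : ℤ, ∑ᶠ t : ℤ × ℤ × ℤ, kzSummand S0 ω₀ z k t = 0 := by
    rw [← finsum_curry _ hfin]
    exact finsum_kzSummand_uncurry S0 ω₀ z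
  refine ⟨hinner, houter, (hS.union houter8).subset (Function.support_add _ _), hzero, ?_⟩
  unfold SKZ
  rw [finsum_add_distrib hS houter8, ← mul_finsum, hzero, mul_zero, add_zero]
end

section
/- Let S⁰ : ℤ → ℝ be finitely supported with S⁰(k) ≥ 0 for all k, and fix real numbers ω₀ and z. Then Σ_{k ∈ ℤ} S_k^{GN}(z) − Σ_{k ∈ ℤ} S⁰(k) = 8 Σ_{k ∈ ℤ} Σ_{(l,m,n) ∈ nr_k} |H(Ω_{lmnk})(z)|² S⁰(l)S⁰(m)S⁰(n) ≥ 0; that is, the total power predicted by the GN power spectral density is at least the input power, so the GN model is not energy preserving whenever the interference sum is positive. -/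
/-- The summand of the GN interference sum at frequency `k`: the value
`|H(Ω_{lmnk})(z)|² S⁰(l)S⁰(m)S⁰(n)` on the non-resonant set
`nr_k = {(l,m,n) : l + m = n + k, l ≠ k, m ≠ k}`, and `0` off it. -/
noncomputable def gnSummand (S0 : ℤ → ℝ) (ω₀ z : ℝ) (k : ℤ)
    (t : ℤ × ℤ × ℤ) : ℝ :=
  if t.1 + t.2.1 = t.2.2 + k ∧ t.1 ≠ k ∧ t.2.1 ≠ k then
    ‖Hfun (Om ω₀ t.1 t.2.1 t.2.2 k) z‖ ^ 2 * (S0 t.1 * S0 t.2.1 * S0 t.2.2)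
  else 0

/-- The (discrete) GN power spectral density at distance `z`. -/
noncomputable def SGN (S0 : ℤ → ℝ) (ω₀ z : ℝ) (k : ℤ) : ℝ :=
  S0 k + 8 * ∑ᶠ t : ℤ × ℤ × ℤ, gnSummand S0 ω₀ z k t

theorem mem_support_of_gnSummand_ne_zero {S0 : ℤ → ℝ} {ω₀ z : ℝ} {k : ℤ} {t : ℤ × ℤ × ℤ}
    (h : gnSummand S0 ω₀ z k t ≠ 0) :
    k = t.1 + t.2.1 - t.2.2 ∧
      t ∈ Function.support S0 ×ˢ (Function.support S0 ×ˢ Function.support S0) := by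
  unfold gnSummand at h
  split_ifs at h with hc
  · have h' := right_ne_zero_of_mul h
    exact ⟨by omega, left_ne_zero_of_mul (left_ne_zero_of_mul h'),
      right_ne_zero_of_mul (left_ne_zero_of_mul h'), right_ne_zero_of_mul h'⟩
  · exact absurd rfl h

theorem gnSummand_nonneg {S0 : ℤ → ℝ} (hpos : ∀ k : ℤ, 0 ≤ S0 k) (ω₀ z : ℝ) (k : ℤ)
    (t : ℤ × ℤ × ℤ) : 0 ≤ gnSummand S0 ω₀ z k t := by
  unfold gnSummand
  split_ifs
  · exact mul_nonneg (sq_nonneg _) (mul_nonneg (mul_nonneg (hpos _) (hpos _)) (hpos _))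
  · exact le_rfl

theorem finite_support_finsum_gnSummand {S0 : ℤ → ℝ} (hS : (Function.support S0).Finite)
    (ω₀ z : ℝ) :
    (Function.support fun k : ℤ => ∑ᶠ t : ℤ × ℤ × ℤ, gnSummand S0 ω₀ z k t).Finite := by
  refine ((hS.prod (hS.prod hS)).image fun t : ℤ × ℤ × ℤ => t.1 + t.2.1 - t.2.2).subset ?_
  intro k hk
  obtain ⟨t, ht⟩ : ∃ t, gnSummand S0 ω₀ z k t ≠ 0 := by
    by_contra! h
    exact hk (finsum_eq_zero_of_forall_eq_zero h)
  obtain ⟨rfl, hmem⟩ := mem_support_of_gnSummand_ne_zero ht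
  exact ⟨t, hmem, rfl⟩

/-- The GN model is not energy preserving: for a finitely supported
nonnegative input spectrum `S⁰`, the total GN power exceeds the input power by
`8 Σ_k Σ_{nr_k} |H(Ω_{lmnk})(z)|² S⁰(l)S⁰(m)S⁰(n) ≥ 0`. -/
theorem gn_not_energy_preserving (S0 : ℤ → ℝ)
    (hS : (Function.support S0).Finite) (hpos : ∀ k : ℤ, 0 ≤ S0 k)
    (ω₀ z : ℝ) :
    (∑ᶠ k : ℤ, SGN S0 ω₀ z k) - (∑ᶠ k : ℤ, S0 k)
        = 8 * ∑ᶠ k : ℤ, ∑ᶠ t : ℤ × ℤ × ℤ, gnSummand S0 ω₀ z k t ∧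
    0 ≤ 8 * ∑ᶠ k : ℤ, ∑ᶠ t : ℤ × ℤ × ℤ, gnSummand S0 ω₀ z k t := by
  have hfin := finite_support_finsum_gnSummand hS ω₀ z
  have hfin8 : (Function.support fun k : ℤ =>
      8 * ∑ᶠ t : ℤ × ℤ × ℤ, gnSummand S0 ω₀ z k t).Finite :=
    hfin.subset fun _ hk => right_ne_zero_of_mul hk
  refine ⟨?_, mul_nonneg (by norm_num)
    (finsum_nonneg fun k => finsum_nonneg fun t => gnSummand_nonneg hpos ω₀ z k t)⟩
  unfold SGN
  rw [finsum_add_distrib hS hfin8, add_sub_cancel_left, ← mul_finsum]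
end

section
/- For every natural number N, all real numbers α and Ω, and every ε > 0, ∫₀^{Nε} exp(−α·(l − ε·⌊l/ε⌋)) · exp(−iΩl) dl = (Σ_{n=0}^{N−1} exp(−i n ε Ω)) · ∫₀^{ε} exp(−(α + iΩ) l) dl, where ⌊·⌋ denotes the floor function. (This factorizes the FWM kernel of a multi-span link with span length ε, constant loss exponent α and lumped amplification into the single-span kernel times the phased-array factor.) -/
open intervalIntegral

/-- On the `n`-th span the multi-span integrand is the single-span integrand translated by `n * ε`,
times the phase accumulated over the first `n` spans. -/
lemma multispan_integrand_eq (n : ℕ) (α Ω : ℝ) {ε l : ℝ} (hε : 0 < ε)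
    (hl : l ∈ Set.Ioo (n * ε) ((n + 1) * ε)) :
    (Real.exp (-(α * (l - ε * (⌊l / ε⌋ : ℤ)))) : ℂ) * Complex.exp (-(Complex.I * Ω * l)) =
      Complex.exp (-(Complex.I * n * ε * Ω)) *
        Complex.exp (-((α : ℂ) + Complex.I * Ω) * ((l - n * ε : ℝ) : ℂ)) := by
  have hfloor : ⌊l / ε⌋ = (n : ℤ) := by
    rw [Int.floor_eq_iff, le_div_iff₀ hε, div_lt_iff₀ hε, Int.cast_natCast]
    exact ⟨hl.1.le, hl.2⟩
  rw [hfloor, Complex.ofReal_exp, ← Complex.exp_add, ← Complex.exp_add]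
  congr 1
  push_cast
  ring

/-- Factorization of the FWM kernel of a multi-span link with `N` spans of
length `ε`, constant loss exponent `α` and lumped amplification: the integral
of the loss-weighted phase factor over the whole link equals the single-span
kernel times the phased-array factor. -/
theorem multispan_kernel_factorization (N : ℕ) (α Ω ε : ℝ) (hε : 0 < ε) :
    (∫ l in (0 : ℝ)..(N * ε),
        (Real.exp (-(α * (l - ε * (⌊l / ε⌋ : ℤ)))) : ℂ) *
          Complex.exp (-(Complex.I * Ω * l)))
      = (∑ n ∈ Finset.range N, Complex.exp (-(Complex.I * n * ε * Ω))) *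
          ∫ l in (0 : ℝ)..ε, Complex.exp (-(((α : ℂ)) + Complex.I * Ω) * l) := by
  set f : ℝ → ℂ := fun l => (Real.exp (-(α * (l - ε * (⌊l / ε⌋ : ℤ)))) : ℂ) *
    Complex.exp (-(Complex.I * Ω * l))
  have hle (n : ℕ) : (n : ℝ) * ε ≤ (n + 1 : ℕ) * ε := by
    gcongr
    simp
  have hfg (n : ℕ) : Set.EqOn f (fun l => Complex.exp (-(Complex.I * n * ε * Ω)) *
      Complex.exp (-((α : ℂ) + Complex.I * Ω) * ((l - n * ε : ℝ) : ℂ)))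
      (Set.uIoo (n * ε) ((n + 1 : ℕ) * ε)) := fun l hl => by
    rw [Set.uIoo_of_le (hle n)] at hl
    exact multispan_integrand_eq n α Ω hε (by simpa using hl)
  have hint (n : ℕ) : IntervalIntegrable f MeasureTheory.volume (n * ε) ((n + 1 : ℕ) * ε) :=
    (intervalIntegrable_congr_uIoo (hfg n)).2 (Continuous.intervalIntegrable (by fun_prop) _ _)
  have hsum := sum_integral_adjacent_intervals (n := N) (a := fun n : ℕ => (n : ℝ) * ε)
    fun n _ => hint n
  simp only [Nat.cast_zero, zero_mul] at hsum
  rw [← hsum, Finset.sum_mul]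
  refine Finset.sum_congr rfl fun n _ => ?_
  rw [integral_congr_uIoo (hfg n), integral_const_mul,
    integral_comp_sub_right (fun l : ℝ => Complex.exp (-((α : ℂ) + Complex.I * Ω) * (l : ℂ)))]
  congr 2 <;> push_cast <;> ring
end

section
/- Let n ≥ 1, let X₁, …, X_{2n} be complex-valued random variables on a probability space, let k₁, …, k_{2n} ∈ ℤ, and let ω₀ ∈ ℝ with ω₀ ≠ 0. Assume that for every t₀ ∈ ℝ the ℂ^{2n}-valued random vectors (X₁, …, X_{2n}) and (exp(i ω₀ k₁ t₀)·X₁, …, exp(i ω₀ k_{2n} t₀)·X_{2n}) are identically distributed, and that the product X₁ ⋯ X_n · conj(X_{n+1}) ⋯ conj(X_{2n}) is integrable. If k₁ + ⋯ + k_n ≠ k_{n+1} + ⋯ + k_{2n}, then E[ X₁ ⋯ X_n · conj(X_{n+1}) ⋯ conj(X_{2n}) ] = 0. -/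
open MeasureTheory
open scoped ComplexConjugate

/-- Spectral moments of a stationary periodic random signal are supported on
the stationary manifold: if for every `t₀` the random vector
`(X₁, …, X_{2n})` has the same distribution as
`(exp(iω₀k₁t₀)X₁, …, exp(iω₀k_{2n}t₀)X_{2n})`, the symmetric product
`X₁⋯X_n conj(X_{n+1})⋯conj(X_{2n})` is integrable, and
`k₁ + ⋯ + k_n ≠ k_{n+1} + ⋯ + k_{2n}`, then the corresponding `2n`-point
spectral moment vanishes. -/
theorem spectral_moment_stationary_manifold
    {α : Type*} [MeasurableSpace α] (μ : Measure α) [IsProbabilityMeasure μ]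
    (n : ℕ) (hn : 1 ≤ n) (X : Fin (2 * n) → α → ℂ)
    (hmeas : ∀ i, Measurable (X i))
    (k : Fin (2 * n) → ℤ) (ω₀ : ℝ) (hω₀ : ω₀ ≠ 0)
    (hstat : ∀ t₀ : ℝ,
      Measure.map (fun a => fun i : Fin (2 * n) => X i a) μ
        = Measure.map (fun a => fun i : Fin (2 * n) =>
            Complex.exp (Complex.I * ω₀ * (k i : ℂ) * t₀) * X i a) μ)
    (hint : Integrable (fun a =>
      ∏ i : Fin (2 * n), if (i : ℕ) < n then X i a else conj (X i a)) μ)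
    (hk : (∑ i : Fin (2 * n), if (i : ℕ) < n then k i else 0)
        ≠ (∑ i : Fin (2 * n), if (i : ℕ) < n then 0 else k i)) :
    ∫ a, (∏ i : Fin (2 * n), if (i : ℕ) < n then X i a else conj (X i a)) ∂μ
      = 0 := by
  set a : Fin (2 * n) → ℤ := fun i => if (i : ℕ) < n then k i else 0 with ha
  set b : Fin (2 * n) → ℤ := fun i => if (i : ℕ) < n then 0 else k i with hb
  have hM : ((∑ i, (a i - b i) : ℤ) : ℂ) ≠ 0 := by
    rw [Finset.sum_sub_distrib]
    exact_mod_cast sub_ne_zero.mpr hk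
  have hω : (ω₀ : ℂ) ≠ 0 := by exact_mod_cast hω₀
  set F : (Fin (2 * n) → ℂ) → ℂ :=
    fun x => ∏ i : Fin (2 * n), if (i : ℕ) < n then x i else conj (x i) with hF
  have hFc : Continuous F := by
    refine continuous_finsetProd _ fun i _ => ?_
    split_ifs
    · exact continuous_apply i
    · exact Complex.continuous_conj.comp (continuous_apply i)
  have hphase (t : ℝ) (x : Fin (2 * n) → ℂ) :
      F (fun i => Complex.exp (Complex.I * ω₀ * (k i : ℂ) * t) * x i)
        = Complex.exp (Complex.I * ω₀ * ((∑ i, (a i - b i) : ℤ) : ℂ) * t) * F x := by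
    rw [Int.cast_sum, Finset.mul_sum, Finset.sum_mul, Complex.exp_sum, hF,
      ← Finset.prod_mul_distrib]
    refine Finset.prod_congr rfl fun i _ => ?_
    by_cases hi : (i : ℕ) < n
    · simp [ha, hb, hi]
    · simp [ha, hb, hi, ← Complex.exp_conj]
  have hshift (t : ℝ) : ∫ y, F (fun i => X i y) ∂μ
      = ∫ y, F (fun i => Complex.exp (Complex.I * ω₀ * (k i : ℂ) * t) * X i y) ∂μ := by
    rw [← integral_map (φ := fun y i => X i y) (measurable_pi_lambda _ hmeas).aemeasurable
        hFc.aestronglyMeasurable, hstat t,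
      integral_map (measurable_pi_lambda _ fun i => (hmeas i).const_mul _).aemeasurable
        hFc.aestronglyMeasurable]
  have hneg := hshift (Real.pi / (ω₀ * ((∑ i, (a i - b i) : ℤ) : ℝ)))
  have hexp : Complex.exp (Complex.I * ω₀ * ((∑ i, (a i - b i) : ℤ) : ℂ)
      * ((Real.pi / (ω₀ * ((∑ i, (a i - b i) : ℤ) : ℝ)) : ℝ) : ℂ)) = -1 := by
    rw [← Complex.exp_pi_mul_I]
    congr 1
    rw [Complex.ofReal_div, Complex.ofReal_mul, Complex.ofReal_intCast]
    field_simp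
  simp_rw [hphase, hexp, neg_one_mul, integral_neg] at hneg
  exact self_eq_neg.mp hneg
end
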